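/- In the combinatorial Marker-Cutter game with initial counter g_0, restricted Cutter has a strategy ensuring that the game reaches a game state of value at least 4g_0/3 + 2. -/

import Mathlib

open scoped Classical

namespace MarkerCutter

/-- Labels for the edges of boundary cycles. -/
abbrev Label := ℕ

/-- A boundary cycle is recorded by the list of its edge labels in cyclic order
(an arbitrary linearisation of the cyclic word; the vertices of the cycle are the
positions between consecutive letters). -/
abbrev Word := List Label

/-- A set of boundary cycles: a multiset of cycles, each a nonempty cyclic word. -/
abbrev Config := Multiset Word

/-- A game state of the combinatorial Marker-Cutter game: a set of labelled boundary
cycles together with the genus counter. -/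
abbrev GState := Config × ℕ

/-- The multiset of all labels appearing on edges (with multiplicity). -/
def allLabels (D : Config) : Multiset Label := D.bind fun w => (w : Multiset Label)

/-- A game state is proper if no component is an isolated vertex and every label
appears on at most two edges. -/
def ProperState (γ : GState) : Prop :=
  ([] : Word) ∉ γ.1 ∧ ∀ a : Label, (allLabels γ.1).count a ≤ 2

/-- The value of a game state: the number of distinct labels appearing on edges. -/
noncomputable def gvalue (γ : GState) : ℕ := (allLabels γ.1).toFinset.card

/-- `w` is a linearisation of the cyclic word `c` read from some other starting vertex. -/
def IsRotationOf (c w : Word) : Prop := ∃ n : ℕ, w = c.rotate n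

/-- A label appearing on exactly one edge. -/
def UniquelyAppearing (D : Config) (a : Label) : Prop := (allLabels D).count a = 1

/-- A label appearing on only one cycle. -/
def IsolatedLabel (D : Config) (a : Label) : Prop := Multiset.countP (fun w => a ∈ w) D ≤ 1

/-- A move of Marker: either two (not necessarily distinct) vertices on a common cycle,
specified by the two segments `P`, `P'` of the cycle between them (with `P = P' = []`
encoding a single dummy vertex chosen twice), or two vertices in different components,
specified by the linearisations `w₁`, `w₂` of the two cycles read from the chosen
vertices (with `[]` encoding a dummy vertex). -/
inductive MChoice : Type
  | same (P P' : Word)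
  | diff (w₁ w₂ : Word)

/-- Validity of a Marker move with respect to the current set of boundary cycles. -/
def MValid (D : Config) : MChoice → Prop
  | .same P P' => (P = [] ∧ P' = []) ∨ ∃ c ∈ D, IsRotationOf c (P ++ P')
  | .diff w₁ w₂ =>
      (w₁ = [] ∧ w₂ = []) ∨
      (w₁ = [] ∧ w₂ ≠ [] ∧ ∃ c ∈ D, IsRotationOf c w₂) ∨
      (w₂ = [] ∧ w₁ ≠ [] ∧ ∃ c ∈ D, IsRotationOf c w₁) ∨
      (w₁ ≠ [] ∧ w₂ ≠ [] ∧ ∃ (D₀ : Config) (c₁ c₂ : Word),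
        D = c₁ ::ₘ c₂ ::ₘ D₀ ∧ IsRotationOf c₁ w₁ ∧ IsRotationOf c₂ w₂)

/-- Cutter's legal responses in the (unrestricted) combinatorial Marker-Cutter game:
moves of type (a), (b), (c) for a `same` choice (keeping an arbitrary union `Dkeep` of the
remaining components and an arbitrary `g' ≤ g` for (b), (c)), and the forced move of
type (d) for a `diff` choice.  The two new edges receive a common fresh label `ℓ`. -/
def CutterResp (γ : GState) (m : MChoice) (γ' : GState) : Prop :=
  ∃ ℓ : Label, ℓ ∉ allLabels γ.1 ∧
    match m with
    | .same P P' =>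
        ∃ Drest : Config,
          ((P = [] ∧ P' = [] ∧ Drest = γ.1) ∨
            (∃ c, γ.1 = c ::ₘ Drest ∧ IsRotationOf c (P ++ P'))) ∧
          ((1 ≤ γ.2 ∧ ∃ Dkeep ≤ Drest,
              γ' = ((P ++ [ℓ]) ::ₘ (P' ++ [ℓ]) ::ₘ Dkeep, γ.2 - 1)) ∨
           (∃ Dkeep ≤ Drest, ∃ g' ≤ γ.2, γ' = ((P ++ [ℓ]) ::ₘ Dkeep, g')) ∨
           (∃ Dkeep ≤ Drest, ∃ g' ≤ γ.2, γ' = ((P' ++ [ℓ]) ::ₘ Dkeep, g')))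
    | .diff w₁ w₂ =>
        ∃ Drest : Config,
          ((w₁ = [] ∧ w₂ = [] ∧ Drest = γ.1) ∨
           (w₁ = [] ∧ w₂ ≠ [] ∧ ∃ c, γ.1 = c ::ₘ Drest ∧ IsRotationOf c w₂) ∨
           (w₂ = [] ∧ w₁ ≠ [] ∧ ∃ c, γ.1 = c ::ₘ Drest ∧ IsRotationOf c w₁) ∨
           (w₁ ≠ [] ∧ w₂ ≠ [] ∧ ∃ c₁ c₂, γ.1 = c₁ ::ₘ c₂ ::ₘ Drest ∧
              IsRotationOf c₁ w₁ ∧ IsRotationOf c₂ w₂)) ∧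
          γ' = ((w₁ ++ [ℓ] ++ w₂ ++ [ℓ]) ::ₘ Drest, γ.2)

/-- The result of a move of type (a) by restricted Cutter (who keeps all other
components and decrements the counter). -/
def RMoveA (γ : GState) (P P' : Word) (γ' : GState) : Prop :=
  ∃ ℓ : Label, ℓ ∉ allLabels γ.1 ∧
    ∃ Drest : Config,
      ((P = [] ∧ P' = [] ∧ Drest = γ.1) ∨
        (∃ c, γ.1 = c ::ₘ Drest ∧ IsRotationOf c (P ++ P'))) ∧
      1 ≤ γ.2 ∧ γ' = ((P ++ [ℓ]) ::ₘ (P' ++ [ℓ]) ::ₘ Drest, γ.2 - 1)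

/-- The result of a move of type (b) by restricted Cutter. -/
def RMoveB (γ : GState) (P P' : Word) (γ' : GState) : Prop :=
  ∃ ℓ : Label, ℓ ∉ allLabels γ.1 ∧
    ∃ Drest : Config,
      ((P = [] ∧ P' = [] ∧ Drest = γ.1) ∨
        (∃ c, γ.1 = c ::ₘ Drest ∧ IsRotationOf c (P ++ P'))) ∧
      γ' = ((P ++ [ℓ]) ::ₘ Drest, γ.2)

/-- The result of a move of type (c) by restricted Cutter. -/
def RMoveC (γ : GState) (P P' : Word) (γ' : GState) : Prop :=
  RMoveB γ P' P γ'

/-- Restricted Cutter's responses: as Cutter's, but in moves of type (a), (b), (c) he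
must keep all remaining components and the counter (except for the decrement in (a)). -/
def RCutterResp (γ : GState) (m : MChoice) (γ' : GState) : Prop :=
  match m with
  | .same P P' => RMoveA γ P P' γ' ∨ RMoveB γ P P' γ' ∨ RMoveC γ P P' γ'
  | .diff w₁ w₂ =>
      ∃ ℓ : Label, ℓ ∉ allLabels γ.1 ∧
        ∃ Drest : Config,
          ((w₁ = [] ∧ w₂ = [] ∧ Drest = γ.1) ∨
           (w₁ = [] ∧ w₂ ≠ [] ∧ ∃ c, γ.1 = c ::ₘ Drest ∧ IsRotationOf c w₂) ∨
           (w₂ = [] ∧ w₁ ≠ [] ∧ ∃ c, γ.1 = c ::ₘ Drest ∧ IsRotationOf c w₁) ∨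
           (w₁ ≠ [] ∧ w₂ ≠ [] ∧ ∃ c₁ c₂, γ.1 = c₁ ::ₘ c₂ ::ₘ Drest ∧
              IsRotationOf c₁ w₁ ∧ IsRotationOf c₂ w₂)) ∧
          γ' = ((w₁ ++ [ℓ] ++ w₂ ++ [ℓ]) ::ₘ Drest, γ.2)

/-- Contraction of a single edge of a set of boundary cycles (deleting the component if it
becomes an isolated vertex). -/
def ContractStep (D D' : Config) : Prop :=
  ∃ (D₀ : Config) (u v : Word) (a : Label),
    D = (u ++ a :: v) ::ₘ D₀ ∧
    ((u = [] ∧ v = [] ∧ D' = D₀) ∨ (u ++ v ≠ [] ∧ D' = (u ++ v) ::ₘ D₀))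

/-- `δ` is a reduction of `γ`: the counter does not increase and the boundary cycles of
`δ` are obtained from those of `γ` by a sequence of contractions. -/
def IsReductionOf (δ γ : GState) : Prop :=
  δ.2 ≤ γ.2 ∧ Relation.ReflTransGen ContractStep γ.1 δ.1

/-- Two game states are equivalent if they differ by a bijective relabelling
(and a change of linearisations of the cyclic words). -/
def EquivStates (γ δ : GState) : Prop :=
  γ.2 = δ.2 ∧ ∃ φ : Label → Label, Function.Bijective φ ∧
    Multiset.Rel (fun w w' => IsRotationOf (w.map φ) w') γ.1 δ.1

/-- `γ'` is equivalent to a reduction of `δ`. -/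
def IsEquivReductionOf (γ' δ : GState) : Prop :=
  ∃ ρ : GState, IsReductionOf ρ δ ∧ EquivStates γ' ρ

/-- A response `γ'` of restricted Cutter is legal with respect to a history `hist` of
earlier game states if it is a restricted response which is not equivalent to a
reduction of any earlier game state. -/
def RCLegal (hist : Set GState) (γ : GState) (m : MChoice) (γ' : GState) : Prop :=
  RCutterResp γ m γ' ∧ ∀ δ ∈ hist, ¬ IsEquivReductionOf γ' δ

end MarkerCutter

namespace MarkerCutter

/-- The potential of the edge at position `i` of the path (`cyc = false`) or cycle
(`cyc = true`) `w`: `3/2` if its label appears exactly once in the whole configuration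
(recorded by the multiset `total` of all labels), `3/4` if it is incident on `w` to
another edge with the same label, and `1/2` otherwise. -/
noncomputable def edgePot (total : Multiset Label) (w : Word) (cyc : Bool) (i : ℕ) : ℚ :=
  if total.count (w.getD i 0) = 1 then 3/2
  else if ∃ j < w.length, j ≠ i ∧ w.getD j 0 = w.getD i 0 ∧
      (j = i + 1 ∨ i = j + 1 ∨
        (cyc = true ∧ 2 ≤ w.length ∧ ((i = 0 ∧ j = w.length - 1) ∨ (j = 0 ∧ i = w.length - 1))))
    then 3/4 else 1/2

/-- The potential of a path (`cyc = false`) or cycle (`cyc = true`) `w`. -/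
noncomputable def wordPot (total : Multiset Label) (w : Word) (cyc : Bool) : ℚ :=
  -2 + ∑ i ∈ Finset.range w.length, edgePot total w cyc i

/-- The potential of a game state (with respect to the initial counter `g₀`):
`4(g₀ - g) - 3 v(γ)` plus the sum of the potentials of all components of positive
potential. -/
noncomputable def statePot (g₀ : ℕ) (γ : GState) : ℚ :=
  4 * ((g₀ : ℚ) - (γ.2 : ℚ)) - 3 * (gvalue γ : ℚ) +
    (γ.1.map fun w => max (wordPot (allLabels γ.1) w true) 0).sum

/-- Nesting paths (recorded by their lists of labels): a single edge with a uniquely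
appearing label, or a path with non-isolated labels `(x, y, z)` such that `x` and `z`
also occur on a cycle with labels `(x, t, z, t)`, and `y` also occurs on a cycle
consisting of an edge labelled `y` together with a nesting path. -/
inductive IsNestingPath (D : Config) : Word → Prop
  | single (a : Label) : UniquelyAppearing D a → IsNestingPath D [a]
  | nest (x y z t : Label) (Q : Word) :
      ¬ IsolatedLabel D x → ¬ IsolatedLabel D y → ¬ IsolatedLabel D z →
      (∃ c ∈ D, IsRotationOf c [x, t, z, t]) →
      (∃ c ∈ D, IsRotationOf c (y :: Q)) →
      IsNestingPath D Q →
      IsNestingPath D [x, y, z]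

/-- A strategy for Marker: a move for every finite history of game states. -/
abbrev MStrategy := (n : ℕ) → (Fin (n + 1) → GState) → MChoice

/-- One round against (unrestricted) Cutter: Marker's choice is valid and Cutter
responds legally (the history is irrelevant). -/
def URespond (_hist : Set GState) (γ : GState) (m : MChoice) (γ' : GState) : Prop :=
  MValid γ.1 m ∧ CutterResp γ m γ'

/-- One round against restricted Cutter: Marker's choice is valid and restricted Cutter
responds with a legal restricted move with respect to the history. -/
def RRespond (hist : Set GState) (γ : GState) (m : MChoice) (γ' : GState) : Prop :=
  MValid γ.1 m ∧ RCLegal hist γ m γ'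

/-- The set of game states occurring in the play up to time `k`. -/
def histSet (play : ℕ → GState) (k : ℕ) : Set GState := {δ | ∃ j ≤ k, play j = δ}

/-- Marker's strategy `σ` limits the value of every game state to `t` in the game with
initial counter `g₀` against a Cutter with response relation `Resp`: along every play
consistent with `σ`, Marker's prescribed choice is always valid and the value of every
game state reached is at most `t`. -/
def MarkerLimits (Resp : Set GState → GState → MChoice → GState → Prop)
    (σ : MStrategy) (g₀ t : ℕ) : Prop :=
  ∀ (n : ℕ) (play : ℕ → GState), play 0 = (0, g₀) →
    (∀ k < n, Resp (histSet play k) (play k)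
      (σ k fun j => play ↑j) (play (k + 1))) →
    MValid (play n).1 (σ n fun j => play ↑j) ∧ gvalue (play n) ≤ t

/-- A strategy for Cutter: a response for every finite history of game states and
valid Marker move. -/
abbrev CStrategy := (n : ℕ) → (Fin (n + 1) → GState) → MChoice → GState

/-- A play consistent with a strategy `τ` of restricted Cutter: at every turn Marker
makes a valid move; if a legal restricted response exists Cutter answers according to
`τ`, and otherwise the game has ended (the state is repeated forever). -/
def RConsistentPlay (τ : CStrategy) (g₀ : ℕ) (play : ℕ → GState) (mk : ℕ → MChoice) : Prop :=
  play 0 = (0, g₀) ∧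
  ∀ k, MValid (play k).1 (mk k) ∧
    ((∃ γ', RRespond (histSet play k) (play k) (mk k) γ') →
      play (k + 1) = τ k (fun j => play ↑j) (mk k)) ∧
    ((¬ ∃ γ', RRespond (histSet play k) (play k) (mk k) γ') → play (k + 1) = play k)

end MarkerCutter

namespace MarkerCutter

/-- The number of pairs of consecutive edges of a path with the same label. -/
def pathTwins : Word → ℕ
  | [] => 0
  | [_] => 0
  | a :: b :: l => (if a = b then 1 else 0) + pathTwins (b :: l)

/-- The number of pairs of cyclically consecutive edges of a cycle with the same label. -/
def cycleTwins : Word → ℕ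
  | [] => 0
  | a :: l => pathTwins (a :: l ++ [a])

lemma pathTwins_append_cons (l m : Word) (x : Label) :
    pathTwins (l ++ x :: m) = pathTwins (l ++ [x]) + pathTwins (x :: m) := by
  induction l with
  | nil => simp [pathTwins]
  | cons a l ih =>
    cases l with
    | nil => simp [pathTwins]
    | cons b l => simp only [List.cons_append, pathTwins] at ih ⊢; omega

lemma pathTwins_add_le (P Q : Word) : pathTwins P + pathTwins Q ≤ pathTwins (P ++ Q) := by
  induction P with
  | nil => simp [pathTwins]
  | cons a P ih =>
    cases P with
    | nil => cases Q <;> simp [pathTwins]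
    | cons b P => simp only [List.cons_append, pathTwins] at ih ⊢; omega

lemma pathTwins_le_cycleTwins (P : Word) : pathTwins P ≤ cycleTwins P := by
  cases P with
  | nil => simp [pathTwins, cycleTwins]
  | cons a P => exact le_trans (Nat.le_add_right _ _) (pathTwins_add_le (a :: P) [a])

lemma pathTwins_cons_of_notMem {l : Label} {P : Word} (h : l ∉ P) :
    pathTwins (l :: P) = pathTwins P := by
  cases P with
  | nil => simp [pathTwins]
  | cons a P => simp_all [pathTwins]

lemma pathTwins_concat_of_notMem {l : Label} {P : Word} (h : l ∉ P) :
    pathTwins (P ++ [l]) = pathTwins P := by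
  induction P with
  | nil => simp [pathTwins]
  | cons a P ih =>
    cases P with
    | nil => simp_all [pathTwins, eq_comm]
    | cons b P => simp_all [pathTwins]

lemma cycleTwins_rotate (c : Word) (n : ℕ) : cycleTwins (c.rotate n) = cycleTwins c := by
  induction n generalizing c with
  | zero => simp
  | succ n ih =>
    cases c with
    | nil => simp
    | cons a c =>
      rw [List.rotate_cons_succ, ih]
      cases c with
      | nil => simp
      | cons b c =>
        have h := pathTwins_append_cons (b :: c) [b] a
        simp only [List.cons_append, List.append_assoc, cycleTwins, pathTwins,
          List.nil_append] at h ⊢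
        rw [h]
        simp only [eq_comm (a := a) (b := b)]
        omega

lemma cycleTwins_concat_le {l : Label} {P : Word} (h : l ∉ P) :
    cycleTwins (P ++ [l]) ≤ pathTwins P + if P = [] then 1 else 0 := by
  cases P with
  | nil => simp [pathTwins, cycleTwins]
  | cons a P =>
    have h1 := pathTwins_append_cons (a :: P) [a] l
    rw [pathTwins_concat_of_notMem h] at h1
    have h2 : l ≠ a := by rintro rfl; simp at h
    simp_all [pathTwins, cycleTwins]

lemma pathTwins_surround_le {l : Label} {w : Word} (h : l ∉ w) :
    pathTwins (l :: w ++ [l]) ≤ pathTwins w + if w = [] then 1 else 0 := by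
  cases w with
  | nil => simp [pathTwins]
  | cons a w =>
    have h2 : l ≠ a := by rintro rfl; simp at h
    have h1 := pathTwins_concat_of_notMem h
    simp_all [pathTwins]

lemma cycleTwins_join_le {l : Label} {w₁ w₂ : Word} (h₁ : l ∉ w₁) (h₂ : l ∉ w₂) :
    cycleTwins (w₁ ++ [l] ++ w₂ ++ [l]) ≤ pathTwins w₁ + pathTwins w₂ +
      (if w₁ = [] then 1 else 0) + (if w₂ = [] then 1 else 0) := by
  have h := pathTwins_surround_le h₂
  cases w₁ with
  | nil =>
    have h1 := pathTwins_append_cons (l :: w₂) [l] l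
    simp only [List.nil_append, List.append_assoc, List.cons_append, pathTwins, cycleTwins,
      if_true] at h h1 ⊢
    omega
  | cons a P =>
    have h1 := pathTwins_append_cons (a :: P) (w₂ ++ [l] ++ [a]) l
    have h3 := pathTwins_append_cons (l :: w₂) [a] l
    rw [pathTwins_concat_of_notMem h₁] at h1
    have h2 : l ≠ a := by rintro rfl; simp at h₁
    simp only [List.nil_append, List.append_assoc, List.cons_append, pathTwins, cycleTwins,
      if_neg h2, reduceCtorEq, if_false] at h h1 h3 ⊢
    omega

/-- Twice the potential of an edge labelled `a`, not counting the bonus for adjacent twins. -/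
def wt (T : Multiset Label) (a : Label) : ℕ := if T.count a = 1 then 3 else 1

/-- The total weight of the edges of a path or cycle. -/
def weight (T : Multiset Label) (w : Word) : ℕ := (w.map (wt T)).sum

/-- Twice the positive part of the potential of a cycle. -/
def pot (T : Multiset Label) (w : Word) : ℕ := weight T w + cycleTwins w - 4

/-- Twice the sum of the positive parts of the potentials of all cycles. -/
def potSum (T : Multiset Label) (D : Config) : ℕ := (D.map (pot T)).sum

@[simp] lemma weight_append (T : Multiset Label) (u v : Word) :
    weight T (u ++ v) = weight T u + weight T v := by simp [weight]

@[simp] lemma weight_singleton (T : Multiset Label) (a : Label) : weight T [a] = wt T a := by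
  simp [weight]

@[simp] lemma potSum_cons (T : Multiset Label) (w : Word) (D : Config) :
    potSum T (w ::ₘ D) = pot T w + potSum T D := by simp [potSum]

@[simp] lemma allLabels_cons (w : Word) (D : Config) :
    allLabels (w ::ₘ D) = (w : Multiset Label) + allLabels D := by simp [allLabels]

@[simp] lemma pot_nil (T : Multiset Label) : pot T [] = 0 := by
  simp [pot, weight, cycleTwins]

lemma one_le_wt (T : Multiset Label) (a : Label) : 1 ≤ wt T a := by
  unfold wt; split_ifs <;> omega

lemma wt_le_three (T : Multiset Label) (a : Label) : wt T a ≤ 3 := by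
  unfold wt; split_ifs <;> omega

lemma length_le_weight (T : Multiset Label) (w : Word) : w.length ≤ weight T w := by
  induction w with
  | nil => simp
  | cons a w ih =>
    have := one_le_wt T a
    simp only [weight, List.map_cons, List.sum_cons, List.length_cons] at ih ⊢
    omega

lemma pot_eq_of_isRotationOf {c w : Word} (h : IsRotationOf c w) (T : Multiset Label) :
    pot T c = pot T w := by
  obtain ⟨n, rfl⟩ := h
  have : weight T (c.rotate n) = weight T c := ((c.rotate_perm n).map _).sum_eq
  rw [pot, pot, cycleTwins_rotate, this]

lemma coe_eq_of_isRotationOf {c w : Word} (h : IsRotationOf c w) :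
    (c : Multiset Label) = w := by
  obtain ⟨n, rfl⟩ := h
  exact (Multiset.coe_eq_coe.2 (c.rotate_perm n)).symm

lemma weight_le (T T' : Multiset Label) (w : Word) :
    weight T' w ≤ weight T w + ((w : Multiset Label).map fun a => wt T' a - wt T a).sum := by
  induction w with
  | nil => simp [weight]
  | cons a w ih =>
    simp only [weight, List.map_cons, List.sum_cons, Multiset.map_coe, Multiset.sum_coe] at ih ⊢
    omega

lemma potSum_le (T T' : Multiset Label) (D : Config) :
    potSum T' D ≤ potSum T D + ((allLabels D).map fun a => wt T' a - wt T a).sum := by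
  induction D using Multiset.induction with
  | empty => simp [potSum]
  | cons w D ih =>
    have := weight_le T T' w
    simp only [potSum_cons, allLabels_cons, Multiset.map_add, Multiset.sum_add, pot]
    omega

lemma card_toFinset_eq_succ {T T' : Multiset Label} {l : Label} (hl : l ∉ T)
    (h : ∀ a, a ∈ T' ↔ a = l ∨ a ∈ T) : T'.toFinset.card = T.toFinset.card + 1 := by
  have : T'.toFinset = insert l T.toFinset := by ext a; simp [h]
  rw [this, Finset.card_insert_of_notMem (by simpa using hl)]

/-- Edges whose weight does not change contribute nothing to the total change. -/
lemma sum_wt_sub_eq_zero {S T T' : Multiset Label} (h : ∀ a ∈ S, T'.count a = T.count a) :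
    (S.map fun a => wt T' a - wt T a).sum = 0 := by
  refine Multiset.sum_eq_zero fun x hx => ?_
  obtain ⟨a, ha, rfl⟩ := Multiset.mem_map.1 hx
  simp [wt, h a ha]

/-- Deleting a set `P` of edges increases the weight of the remaining edges by at most `2` per
deleted edge. -/
lemma sum_wt_sub_le {S T T' : Multiset Label} {P : Word} {l : Label} (hT : T = S + P)
    (hT' : T' = S + {l}) (hl : l ∉ T) :
    (S.map fun a => wt T' a - wt T a).sum ≤ 2 * P.length := by
  have hc : ∀ a ∈ S, T'.count a = S.count a := by
    intro a ha
    have : a ≠ l := by rintro rfl; exact hl (by simp [hT, ha])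
    simp [hT', this]
  have key : ∀ a ∈ S.toFinset, S.count a • (wt T' a - wt T a) ≤ if a ∈ P then 2 else 0 := by
    intro a ha
    have h1 := hc a (by simpa using ha)
    have h2 : T.count a = S.count a + P.count a := by simp [hT]
    simp only [wt, h1, h2, smul_eq_mul]
    by_cases hP : a ∈ P
    · by_cases hS : S.count a = 1
      · simp only [hS, hP]; split_ifs <;> omega
      · have : (if S.count a + P.count a = 1 then 3 else 1) ≥ 1 := by split_ifs <;> omega
        simp only [hS, hP, if_true, if_false]
        rw [Nat.sub_eq_zero_of_le this]
        omega
    · simp [List.count_eq_zero_of_not_mem hP]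
  rw [Finset.sum_multiset_map_count]
  refine (Finset.sum_le_sum key).trans ?_
  rw [← Finset.sum_filter, Finset.sum_const, smul_eq_mul, mul_comm]
  refine Nat.mul_le_mul_left 2 (le_trans (Finset.card_le_card ?_) P.toFinset_card_le)
  intro a ha
  simpa using (Finset.mem_filter.1 ha).2

/-- A light path consists of at most two edges whose labels all survive its deletion. -/
lemma light_path {S T : Multiset Label} {P : Word} (hT : T = S + P)
    (h : weight T P + pathTwins P ≤ 2) : P.length ≤ 2 ∧ ∀ a ∈ P, a ∈ S := by
  refine ⟨by have := length_le_weight T P; omega, fun a ha => ?_⟩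
  by_contra hS
  have h1 : T.count a = P.count a := by simp [hT, hS]
  match P, h, ha, h1 with
  | [b], h, ha, h1 =>
    obtain rfl : a = b := by simpa using ha
    simp [wt, h1, pathTwins] at h
  | [b, c], h, ha, h1 =>
    have hb := one_le_wt T b
    have hc := one_le_wt T c
    simp only [weight, pathTwins, List.map_cons, List.map_nil, List.sum_cons, List.sum_nil] at h
    by_cases hbc : b = c
    · simp only [hbc, if_true] at h hb; omega
    · have hw : wt T a = 3 := by
        rw [wt, if_pos]
        rw [h1]
        simp only [List.mem_cons, List.not_mem_nil, or_false] at ha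
        rcases ha with rfl | rfl
        · simp [Ne.symm hbc]
        · simp [hbc]
      simp only [List.mem_cons, List.not_mem_nil, or_false] at ha
      rcases ha with rfl | rfl <;> omega
  | b :: c :: d :: P, h, _, _ =>
    have := length_le_weight T (b :: c :: d :: P)
    simp only [List.length_cons] at this
    omega

/-- Effect on value and potential of discarding a light path. -/
lemma discard_light {T : Multiset Label} {R : Config} {P P' : Word} {l : Label}
    (hT : T = (P : Multiset Label) + P' + allLabels R) (hl : l ∉ T)
    (h : weight T P' + pathTwins P' ≤ 2) :
    (allLabels ((P ++ [l]) ::ₘ R)).toFinset.card = T.toFinset.card + 1 ∧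
    potSum (allLabels ((P ++ [l]) ::ₘ R)) ((P ++ [l]) ::ₘ R) ≤
      pot T (P ++ P') + potSum T R + 3 + P'.length ∧ P'.length ≤ 2 := by
  have hT1 : T = ((P : Multiset Label) + allLabels R) + P' := by rw [hT]; abel
  obtain ⟨hlen, hmem⟩ := light_path hT1 h
  refine ⟨card_toFinset_eq_succ hl fun a => ?_, ?_, hlen⟩
  · have := hmem a
    simp only [hT, allLabels_cons, Multiset.mem_add, Multiset.mem_coe, List.mem_append,
      List.mem_singleton] at this ⊢
    tauto
  · set T' := allLabels ((P ++ [l]) ::ₘ R) with hT'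
    have hT'1 : T' = ((P : Multiset Label) + allLabels R) + {l} := by
      rw [hT', allLabels_cons, ← Multiset.coe_add, Multiset.coe_singleton]; abel
    have h1 := sum_wt_sub_le hT1 hT'1 hl
    have h2 := weight_le T T' P
    have h3 := potSum_le T T' R
    have hlP : l ∉ P := fun hm => hl (by simp [hT, hm])
    have h4 := cycleTwins_concat_le hlP
    have h5 := pathTwins_le_cycleTwins (P ++ P')
    have h6 := pathTwins_add_le P P'
    have h7 := length_le_weight T P'
    have h8 := wt_le_three T' l
    rw [Multiset.map_add, Multiset.sum_add] at h1
    simp only [potSum_cons, pot, weight_append, weight_singleton]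
    by_cases hP : P = []
    · subst hP
      simp only [pathTwins, weight, List.map_nil, List.sum_nil, if_true] at *
      omega
    · simp only [hP, if_false] at h4
      omega

/-- Effect on value and potential of a split into two heavy paths. -/
lemma split_heavy {T : Multiset Label} {R : Config} {P P' : Word} {l : Label}
    (hT : T = (P : Multiset Label) + P' + allLabels R) (hl : l ∉ T)
    (h : 3 ≤ weight T P + pathTwins P) (h' : 3 ≤ weight T P' + pathTwins P') :
    (allLabels ((P ++ [l]) ::ₘ (P' ++ [l]) ::ₘ R)).toFinset.card = T.toFinset.card + 1 ∧
    potSum (allLabels ((P ++ [l]) ::ₘ (P' ++ [l]) ::ₘ R)) ((P ++ [l]) ::ₘ (P' ++ [l]) ::ₘ R) + 2 ≤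
      pot T (P ++ P') + potSum T R := by
  refine ⟨card_toFinset_eq_succ hl fun a => ?_, ?_⟩
  · simp only [hT, allLabels_cons, Multiset.mem_add, Multiset.mem_coe, List.mem_append,
      List.mem_singleton]
    tauto
  · set T' := allLabels ((P ++ [l]) ::ₘ (P' ++ [l]) ::ₘ R) with hT'
    have hT'1 : T' = T + {l} + {l} := by
      rw [hT', hT, allLabels_cons, allLabels_cons, ← Multiset.coe_add, ← Multiset.coe_add,
        Multiset.coe_singleton]
      abel
    have hz : (T.map fun a => wt T' a - wt T a).sum = 0 := by
      refine sum_wt_sub_eq_zero fun a ha => ?_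
      have : a ≠ l := by rintro rfl; exact hl ha
      simp [hT'1, this]
    have hwl : wt T' l = 1 := by simp [wt, hT'1]
    conv at hz => lhs; rw [hT, Multiset.map_add, Multiset.map_add, Multiset.sum_add,
      Multiset.sum_add, ← hT]
    have h1 := weight_le T T' P
    have h2 := weight_le T T' P'
    have h3 := potSum_le T T' R
    have hlP : l ∉ P := fun hm => hl (by simp [hT, hm])
    have hlP' : l ∉ P' := fun hm => hl (by simp [hT, hm])
    have h4 := cycleTwins_concat_le hlP
    have h4' := cycleTwins_concat_le hlP'
    have h5 := pathTwins_le_cycleTwins (P ++ P')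
    have h6 := pathTwins_add_le P P'
    have hP : P ≠ [] := by rintro rfl; simp [weight, pathTwins] at h
    have hP' : P' ≠ [] := by rintro rfl; simp [weight, pathTwins] at h'
    simp only [hP, hP', if_false] at h4 h4'
    simp only [potSum_cons, pot, weight_append, weight_singleton]
    omega

/-- Effect on value and potential of amalgamating two cycles. -/
lemma amalgamate {T : Multiset Label} {R : Config} {w₁ w₂ : Word} {l : Label}
    (hT : T = (w₁ : Multiset Label) + w₂ + allLabels R) (hl : l ∉ T) :
    (allLabels ((w₁ ++ [l] ++ w₂ ++ [l]) ::ₘ R)).toFinset.card = T.toFinset.card + 1 ∧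
    potSum (allLabels ((w₁ ++ [l] ++ w₂ ++ [l]) ::ₘ R)) ((w₁ ++ [l] ++ w₂ ++ [l]) ::ₘ R) ≤
      pot T w₁ + pot T w₂ + potSum T R + (if w₁ = [] ∨ w₂ = [] then 3 else 6) := by
  refine ⟨card_toFinset_eq_succ hl fun a => ?_, ?_⟩
  · simp only [hT, allLabels_cons, Multiset.mem_add, Multiset.mem_coe, List.mem_append,
      List.mem_singleton]
    tauto
  · set T' := allLabels ((w₁ ++ [l] ++ w₂ ++ [l]) ::ₘ R) with hT'
    have hT'1 : T' = T + {l} + {l} := by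
      rw [hT', hT, allLabels_cons, ← Multiset.coe_add, ← Multiset.coe_add, ← Multiset.coe_add,
        Multiset.coe_singleton]
      abel
    have hz : (T.map fun a => wt T' a - wt T a).sum = 0 := by
      refine sum_wt_sub_eq_zero fun a ha => ?_
      have : a ≠ l := by rintro rfl; exact hl ha
      simp [hT'1, this]
    have hwl : wt T' l = 1 := by simp [wt, hT'1]
    conv at hz => lhs; rw [hT, Multiset.map_add, Multiset.map_add, Multiset.sum_add,
      Multiset.sum_add, ← hT]
    have h1 := weight_le T T' w₁
    have h2 := weight_le T T' w₂
    have h3 := potSum_le T T' R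
    have hl₁ : l ∉ w₁ := fun hm => hl (by simp [hT, hm])
    have hl₂ : l ∉ w₂ := fun hm => hl (by simp [hT, hm])
    have h4 := cycleTwins_join_le hl₁ hl₂
    have h5 := pathTwins_le_cycleTwins w₁
    have h5' := pathTwins_le_cycleTwins w₂
    have hnil : weight T [] = 0 := rfl
    have hnil' : weight T' [] = 0 := rfl
    simp only [potSum_cons, pot, weight_append, weight_singleton, hwl]
    by_cases e₁ : w₁ = [] <;> by_cases e₂ : w₂ = [] <;>
      simp only [e₁, e₂, if_true, if_false, true_or, or_true, or_self, pathTwins, cycleTwins,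
        hnil, hnil', List.nil_append, List.append_nil] at * <;> omega

/-- The invariant maintained by Cutter: apart from the first two turns, the potential of the game
state is at most `-9/2`. -/
def Invariant (g₀ : ℕ) (γ : GState) : Prop :=
  (γ.1 = 0 ∧ γ.2 = g₀) ∨ ((∃ a, γ.1 = {[a]} ∨ γ.1 = {[a, a]}) ∧ γ.2 = g₀) ∨
    8 * g₀ + potSum (allLabels γ.1) γ.1 + 9 ≤ 8 * γ.2 + 6 * gvalue γ

lemma exists_rest_of_same {D : Config} {P P' : Word} (h : MValid D (.same P P')) :
    ∃ R : Config, ((P = [] ∧ P' = [] ∧ R = D) ∨ ∃ c, D = c ::ₘ R ∧ IsRotationOf c (P ++ P')) ∧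
      allLabels D = (P : Multiset Label) + P' + allLabels R ∧
      potSum (allLabels D) D = pot (allLabels D) (P ++ P') + potSum (allLabels D) R := by
  rcases h with ⟨rfl, rfl⟩ | ⟨c, hc, hr⟩
  · exact ⟨D, .inl ⟨rfl, rfl, rfl⟩, by simp, by simp⟩
  · obtain ⟨R, hR⟩ := Multiset.exists_cons_of_mem hc
    refine ⟨R, .inr ⟨c, hR, hr⟩, ?_, ?_⟩
    · rw [hR, allLabels_cons, coe_eq_of_isRotationOf hr, ← Multiset.coe_add]
    · conv_lhs => arg 2; rw [hR]
      rw [potSum_cons, pot_eq_of_isRotationOf hr]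

lemma exists_rest_of_diff {D : Config} {w₁ w₂ : Word} (h : MValid D (.diff w₁ w₂)) :
    ∃ R : Config, ((w₁ = [] ∧ w₂ = [] ∧ R = D) ∨
        (w₁ = [] ∧ w₂ ≠ [] ∧ ∃ c, D = c ::ₘ R ∧ IsRotationOf c w₂) ∨
        (w₂ = [] ∧ w₁ ≠ [] ∧ ∃ c, D = c ::ₘ R ∧ IsRotationOf c w₁) ∨
        (w₁ ≠ [] ∧ w₂ ≠ [] ∧ ∃ c₁ c₂, D = c₁ ::ₘ c₂ ::ₘ R ∧
          IsRotationOf c₁ w₁ ∧ IsRotationOf c₂ w₂)) ∧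
      allLabels D = (w₁ : Multiset Label) + w₂ + allLabels R ∧
      potSum (allLabels D) D =
        pot (allLabels D) w₁ + pot (allLabels D) w₂ + potSum (allLabels D) R := by
  rcases h with ⟨rfl, rfl⟩ | ⟨rfl, hne, c, hc, hr⟩ | ⟨rfl, hne, c, hc, hr⟩ |
    ⟨h₁, h₂, R, c₁, c₂, hR, hr₁, hr₂⟩
  · exact ⟨D, .inl ⟨rfl, rfl, rfl⟩, by simp, by simp⟩
  · obtain ⟨R, hR⟩ := Multiset.exists_cons_of_mem hc
    refine ⟨R, .inr (.inl ⟨rfl, hne, c, hR, hr⟩), ?_, ?_⟩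
    · rw [hR, allLabels_cons, coe_eq_of_isRotationOf hr]; simp
    · conv_lhs => arg 2; rw [hR]
      rw [potSum_cons, pot_eq_of_isRotationOf hr]; simp
  · obtain ⟨R, hR⟩ := Multiset.exists_cons_of_mem hc
    refine ⟨R, .inr (.inr (.inl ⟨rfl, hne, c, hR, hr⟩)), ?_, ?_⟩
    · rw [hR, allLabels_cons, coe_eq_of_isRotationOf hr]; simp
    · conv_lhs => arg 2; rw [hR]
      rw [potSum_cons, pot_eq_of_isRotationOf hr]; simp
  · refine ⟨R, .inr (.inr (.inr ⟨h₁, h₂, c₁, c₂, hR, hr₁, hr₂⟩)), ?_, ?_⟩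
    · rw [hR, allLabels_cons, allLabels_cons, coe_eq_of_isRotationOf hr₁,
        coe_eq_of_isRotationOf hr₂, add_assoc]
    · conv_lhs => arg 2; rw [hR]
      rw [potSum_cons, potSum_cons, pot_eq_of_isRotationOf hr₁, pot_eq_of_isRotationOf hr₂,
        add_assoc]

lemma exists_fresh (D : Config) : ∃ l : Label, l ∉ allLabels D := by
  obtain ⟨l, hl⟩ := Infinite.exists_notMem_finset (allLabels D).toFinset
  exact ⟨l, by simpa using hl⟩

/-- A game state consisting of a single cycle with labels `(a)` or `(a, a)`. -/
lemma potSum_and_gvalue_of_small {γ : GState} {a : Label} (h : γ.1 = {[a]} ∨ γ.1 = {[a, a]}) :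
    potSum (allLabels γ.1) γ.1 = 0 ∧ gvalue γ = 1 := by
  unfold gvalue
  rcases h with h | h <;> rw [h] <;> constructor <;>
    simp [potSum, allLabels, pot, weight, wt, cycleTwins, pathTwins]

/-- Splitting a cycle with labels `(a)` or `(a, a)` into two nonempty paths. -/
lemma eq_singleton_of_small {c P P' : Word} {a : Label} (h : c = [a] ∨ c = [a, a])
    (hr : IsRotationOf c (P ++ P')) (hP : P ≠ []) (hP' : P' ≠ []) : P = [a] ∧ P' = [a] := by
  have hlen : (P ++ P').length = c.length := by obtain ⟨n, hn⟩ := hr; simp [hn]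
  have hmem : ∀ b ∈ P ++ P', b = a := by
    intro b hb
    obtain ⟨n, hn⟩ := hr
    rw [hn, List.mem_rotate] at hb
    rcases h with rfl | rfl <;> simpa using hb
  have h1 := List.length_pos_iff.2 hP
  have h2 := List.length_pos_iff.2 hP'
  rw [List.length_append] at hlen
  have h3 : c.length ≤ 2 := by rcases h with rfl | rfl <;> simp
  obtain ⟨b, rfl⟩ := List.length_eq_one_iff.1 (show P.length = 1 by omega)
  obtain ⟨b', rfl⟩ := List.length_eq_one_iff.1 (show P'.length = 1 by omega)
  exact ⟨by rw [hmem b (by simp)], by rw [hmem b' (by simp)]⟩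

/-- If one of the two paths is light, then discarding it preserves the invariant. -/
lemma exists_moveB {g₀ : ℕ} {γ : GState} (hγ : Invariant g₀ γ) {P P' : Word}
    (hm : MValid γ.1 (.same P P'))
    (h : weight (allLabels γ.1) P' + pathTwins P' ≤ 2)
    (hP : P = [] → P' = []) :
    ∃ γ', RMoveB γ P P' γ' ∧ gvalue γ' = gvalue γ + 1 ∧ Invariant g₀ γ' := by
  obtain ⟨R, hR, hT, hpot⟩ := exists_rest_of_same hm
  obtain ⟨l, hl⟩ := exists_fresh γ.1
  obtain ⟨h1, h2, h3⟩ := discard_light hT hl h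
  refine ⟨((P ++ [l]) ::ₘ R, γ.2), ⟨l, hl, R, hR, rfl⟩, h1, ?_⟩
  have hv : gvalue ((P ++ [l]) ::ₘ R, γ.2) = gvalue γ + 1 := h1
  rcases hγ with ⟨h0, hg⟩ | ⟨⟨a, ha⟩, hg⟩ | hbig
  · refine .inr (.inl ⟨⟨l, .inl ?_⟩, hg⟩)
    rcases hR with ⟨rfl, -, rfl⟩ | ⟨c, hc, -⟩
    · simp [h0]
    · simp [h0] at hc
  · obtain ⟨hp, hv1⟩ := potSum_and_gvalue_of_small ha
    refine .inr (.inr ?_)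
    by_cases hP' : P' = []
    · subst hP'
      simp only [List.length_nil] at h2 ⊢
      omega
    · have hPne : P ≠ [] := fun e => hP' (hP e)
      rcases hR with ⟨rfl, -⟩ | ⟨c, hc, hr⟩
      · exact absurd rfl hPne
      · have hcR : (c = [a] ∨ c = [a, a]) ∧ R = 0 := by
          rcases ha with ha | ha <;> rw [ha, ← Multiset.cons_zero] at hc <;>
            rw [eq_comm, Multiset.cons_eq_cons] at hc <;> simp at hc <;> simp [hc]
        obtain ⟨rfl, rfl⟩ := eq_singleton_of_small hcR.1 hr hPne hP'
        have hla : l ≠ a := by rintro rfl; exact hl (by simp [hT])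
        have : potSum (allLabels (([a] ++ [l]) ::ₘ R)) (([a] ++ [l]) ::ₘ R) = 2 := by
          rw [hcR.2]
          simp [potSum, allLabels, pot, weight, wt, cycleTwins, pathTwins, hla, hla.symm]
        simp only [this]
        omega
  · refine .inr (.inr ?_)
    simp only
    omega

/-- Unless the value is already large, Cutter can answer every move of Marker such that the value
increases and the invariant is preserved. -/
lemma exists_response {g₀ : ℕ} {γ : GState} (hγ : Invariant g₀ γ)
    (hlow : 3 * gvalue γ < 4 * g₀ + 6) {m : MChoice} (hm : MValid γ.1 m) :
    ∃ γ', RCutterResp γ m γ' ∧ gvalue γ' = gvalue γ + 1 ∧ Invariant g₀ γ' := by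
  cases m with
  | same P P' =>
    by_cases h' : weight (allLabels γ.1) P' + pathTwins P' ≤ 2 ∧ (P = [] → P' = [])
    · obtain ⟨γ', h1, h2⟩ := exists_moveB hγ hm h'.1 h'.2
      exact ⟨γ', .inr (.inl h1), h2⟩
    have hm' : MValid γ.1 (.same P' P) := by
      rcases hm with ⟨h1, h2⟩ | ⟨c, hc, n, hn⟩
      · exact .inl ⟨h2, h1⟩
      · refine .inr ⟨c, hc, n + P.length, ?_⟩
        rw [← List.rotate_rotate, ← hn, List.rotate_append_length_eq]
    by_cases h : weight (allLabels γ.1) P + pathTwins P ≤ 2 ∧ (P' = [] → P = [])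
    · obtain ⟨γ', h1, h2⟩ := exists_moveB hγ hm' h.1 h.2
      exact ⟨γ', .inr (.inr h1), h2⟩
    have hnil : weight (allLabels γ.1) [] + pathTwins [] = 0 := rfl
    have hne : P ≠ [] ∧ P' ≠ [] := by
      refine ⟨?_, ?_⟩ <;> rintro rfl <;> simp_all
    have hP : 3 ≤ weight (allLabels γ.1) P + pathTwins P := by
      by_contra hlt
      exact h ⟨by omega, fun e => absurd e hne.2⟩
    have hP' : 3 ≤ weight (allLabels γ.1) P' + pathTwins P' := by
      by_contra hlt
      exact h' ⟨by omega, fun e => absurd e hne.1⟩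
    obtain ⟨R, hR, hT, hpot⟩ := exists_rest_of_same hm
    obtain ⟨l, hl⟩ := exists_fresh γ.1
    obtain ⟨h1, h2⟩ := split_heavy hT hl hP hP'
    have hbig : 8 * g₀ + potSum (allLabels γ.1) γ.1 + 9 ≤ 8 * γ.2 + 6 * gvalue γ := by
      rcases hγ with ⟨h0, -⟩ | ⟨⟨a, ha⟩, -⟩ | hbig
      · have : potSum (allLabels γ.1) γ.1 = 0 := by rw [h0]; rfl
        omega
      · have := (potSum_and_gvalue_of_small ha).1
        omega
      · exact hbig
    have hg : 1 ≤ γ.2 := by omega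
    refine ⟨((P ++ [l]) ::ₘ (P' ++ [l]) ::ₘ R, γ.2 - 1), .inl ⟨l, hl, R, hR, hg, rfl⟩, h1,
      .inr (.inr ?_)⟩
    have hv : gvalue ((P ++ [l]) ::ₘ (P' ++ [l]) ::ₘ R, γ.2 - 1) = gvalue γ + 1 := h1
    simp only
    omega
  | diff w₁ w₂ =>
    obtain ⟨R, hR, hT, hpot⟩ := exists_rest_of_diff hm
    obtain ⟨l, hl⟩ := exists_fresh γ.1
    obtain ⟨h1, h2⟩ := amalgamate hT hl
    refine ⟨((w₁ ++ [l] ++ w₂ ++ [l]) ::ₘ R, γ.2), ⟨l, hl, R, hR, rfl⟩, h1, ?_⟩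
    have hv : gvalue ((w₁ ++ [l] ++ w₂ ++ [l]) ::ₘ R, γ.2) = gvalue γ + 1 := h1
    rcases hγ with ⟨h0, hg⟩ | ⟨⟨a, ha⟩, hg⟩ | hbig
    · refine .inr (.inl ⟨⟨l, .inr ?_⟩, hg⟩)
      rcases hR with ⟨rfl, rfl, rfl⟩ | ⟨-, -, c, hc, -⟩ | ⟨-, -, c, hc, -⟩ | ⟨-, -, c, c', hc, -⟩
      · simp [h0]
      all_goals simp [h0] at hc
    · obtain ⟨hp, hv1⟩ := potSum_and_gvalue_of_small ha
      have hdummy : w₁ = [] ∨ w₂ = [] := by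
        rcases hR with ⟨rfl, -⟩ | ⟨rfl, -⟩ | ⟨rfl, -⟩ | ⟨-, -, c, c', hc, -⟩
        · simp
        · simp
        · simp
        · have := congrArg Multiset.card hc
          rcases ha with ha | ha <;> simp [ha] at this
      rw [if_pos hdummy] at h2
      refine .inr (.inr ?_)
      simp only
      omega
    · refine .inr (.inr ?_)
      have : (if w₁ = [] ∨ w₂ = [] then 3 else 6) ≤ 6 := by split_ifs <;> omega
      simp only
      omega

lemma allLabels_le_of_contractStep {D D' : Config} (h : ContractStep D D') :
    allLabels D' ≤ allLabels D := by
  obtain ⟨D₀, u, v, a, rfl, ⟨-, -, rfl⟩ | ⟨-, rfl⟩⟩ := h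
  · simp
  · simp only [allLabels_cons]
    refine add_le_add_left ?_ _
    exact Multiset.coe_le.2 (List.Sublist.subperm (by simp))

lemma gvalue_le_of_isReductionOf {δ γ : GState} (h : IsReductionOf δ γ) :
    gvalue δ ≤ gvalue γ := by
  have : allLabels δ.1 ≤ allLabels γ.1 := by
    have h := h.2
    generalize δ.1 = D at h ⊢
    induction h with
    | refl => rfl
    | tail _ hs ih => exact (allLabels_le_of_contractStep hs).trans ih
  exact Finset.card_le_card (Multiset.toFinset_subset.2 (Multiset.subset_of_le this))

lemma gvalue_eq_of_equivStates {γ δ : GState} (h : EquivStates γ δ) : gvalue γ = gvalue δ := by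
  obtain ⟨-, φ, hφ, hrel⟩ := h
  have : allLabels δ.1 = (allLabels γ.1).map φ := by
    generalize γ.1 = D, δ.1 = D' at hrel ⊢
    induction hrel with
    | zero => simp [allLabels]
    | cons hr _ ih =>
      rw [allLabels_cons, allLabels_cons, ih, Multiset.map_add, ← coe_eq_of_isRotationOf hr,
        Multiset.map_coe]
  unfold gvalue
  rw [this, Multiset.toFinset_map, Finset.card_image_of_injective _ hφ.1]

lemma gvalue_le_of_isEquivReductionOf {γ δ : GState} (h : IsEquivReductionOf γ δ) :
    gvalue γ ≤ gvalue δ := by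
  obtain ⟨ρ, hρ, he⟩ := h
  exact (gvalue_eq_of_equivStates he).trans_le (gvalue_le_of_isReductionOf hρ)

lemma range_eq_histSet (play : ℕ → GState) (k : ℕ) :
    Set.range (fun j : Fin (k + 1) => play ↑j) = histSet play k := by
  ext δ
  constructor
  · rintro ⟨j, rfl⟩
    exact ⟨j, Nat.lt_succ_iff.1 j.2, rfl⟩
  · rintro ⟨j, hj, rfl⟩
    exact ⟨⟨j, Nat.lt_succ_iff.2 hj⟩, rfl⟩

/-- A legal response which increases the value by one and preserves the invariant. -/
def IsGoodResponse (g₀ : ℕ) (hist : Set GState) (γ : GState) (m : MChoice) (γ' : GState) : Prop :=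
  RRespond hist γ m γ' ∧ gvalue γ' = gvalue γ + 1 ∧ Invariant g₀ γ'

/-- Cutter's strategy: play a good response if possible, and any legal response otherwise. -/
noncomputable def cutterStrategy (g₀ : ℕ) : CStrategy := fun k h m =>
  if hg : ∃ γ', IsGoodResponse g₀ (Set.range h) (h (Fin.last k)) m γ' then hg.choose
  else if hr : ∃ γ', RRespond (Set.range h) (h (Fin.last k)) m γ' then hr.choose
  else h (Fin.last k)

lemma cutterStrategy_good {g₀ k : ℕ} {play : ℕ → GState} {m : MChoice}
    (h : ∃ γ', IsGoodResponse g₀ (histSet play k) (play k) m γ') :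
    IsGoodResponse g₀ (histSet play k) (play k) m
      (cutterStrategy g₀ k (fun j => play ↑j) m) := by
  simp only [cutterStrategy, range_eq_histSet, Fin.val_last]
  rw [dif_pos h]
  exact h.choose_spec

lemma cutterStrategy_legal {g₀ k : ℕ} {play : ℕ → GState} {m : MChoice}
    (h : ∃ γ', RRespond (histSet play k) (play k) m γ') :
    RRespond (histSet play k) (play k) m (cutterStrategy g₀ k (fun j => play ↑j) m) := by
  by_cases hg : ∃ γ', IsGoodResponse g₀ (histSet play k) (play k) m γ'
  · exact (cutterStrategy_good hg).1
  · simp only [cutterStrategy, range_eq_histSet, Fin.val_last]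
    rw [dif_neg hg, dif_pos h]
    exact h.choose_spec

theorem stmt19 (g₀ : ℕ) :
    ∃ τ : CStrategy,
      ∀ (play : ℕ → GState) (mk : ℕ → MChoice), RConsistentPlay τ g₀ play mk →
        (∀ k, (∃ γ', RRespond (histSet play k) (play k) (mk k) γ') →
          RRespond (histSet play k) (play k) (mk k) (τ k (fun j => play ↑j) (mk k))) ∧
        ∃ n, 4 * g₀ + 6 ≤ 3 * gvalue (play n) := by
  refine ⟨cutterStrategy g₀, fun play mk hplay => ⟨fun k => cutterStrategy_legal, ?_⟩⟩
  by_contra! hlow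
  have key : ∀ n, Invariant g₀ (play n) ∧ gvalue (play n) = n ∧
      ∀ j ≤ n, gvalue (play j) ≤ gvalue (play n) := by
    intro n
    induction n with
    | zero =>
      rw [hplay.1]
      refine ⟨.inl ⟨rfl, rfl⟩, rfl, fun j hj => ?_⟩
      rw [Nat.le_zero.1 hj, hplay.1]
    | succ n ih =>
      obtain ⟨hinv, hval, hmono⟩ := ih
      obtain ⟨hm, hstep, -⟩ := hplay.2 n
      obtain ⟨γ', h1, h2, h3⟩ := exists_response hinv (hlow n) hm
      have hgood : ∃ γ', IsGoodResponse g₀ (histSet play n) (play n) (mk n) γ' := by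
        refine ⟨γ', ⟨hm, h1, ?_⟩, h2, h3⟩
        rintro δ ⟨j, hj, rfl⟩ hred
        have := gvalue_le_of_isEquivReductionOf hred
        have := hmono j hj
        omega
      have hnext := cutterStrategy_good hgood
      rw [← hstep ⟨_, hnext.1⟩] at hnext
      refine ⟨hnext.2.2, by rw [hnext.2.1, hval], fun j hj => ?_⟩
      rcases Nat.le_succ_iff.1 hj with hj | rfl
      · have := hmono j hj
        have := hnext.2.1
        omega
      · exact le_rfl
  have h1 := hlow (4 * g₀ + 6)
  have h2 := (key (4 * g₀ + 6)).2.1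
  omega

end MarkerCutter
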